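/- Under the Krawczyk hypothesis, the quasi-Newton map N(y) := y − A·F(y) is ρ-Lipschitz on the box x + rB with respect to the real sup-norm: for all y, z ∈ x + rB one has ‖N(y) − N(z)‖ ≤ ρ·‖y − z‖. -/

import Mathlib

/-- The real sup-norm on `ℂⁿ`: `‖v‖ = max_i max(|Re vᵢ|, |Im vᵢ|)`. -/
noncomputable def boxNorm {n : ℕ} (v : Fin n → ℂ) : ℝ :=
  ⨆ i : Fin n, max |(v i).re| |(v i).im|

theorem boxNorm_nonneg {n : ℕ} (v : Fin n → ℂ) : 0 ≤ boxNorm v :=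
  Real.iSup_nonneg fun _ => le_max_of_le_left (abs_nonneg _)

theorem boxNorm_le_iff {n : ℕ} {v : Fin n → ℂ} {c : ℝ} (hc : 0 ≤ c) :
    boxNorm v ≤ c ↔ ∀ i, |(v i).re| ≤ c ∧ |(v i).im| ≤ c := by
  constructor
  · intro h i
    exact max_le_iff.1 ((le_ciSup (f := fun i => max |(v i).re| |(v i).im|)
      (Set.finite_range _).bddAbove i).trans h)
  · intro h
    exact Real.iSup_le (fun i => max_le (h i).1 (h i).2) hc

theorem boxNorm_add_le {n : ℕ} (v w : Fin n → ℂ) :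
    boxNorm (v + w) ≤ boxNorm v + boxNorm w := by
  have hv := (boxNorm_le_iff (boxNorm_nonneg v)).1 le_rfl
  have hw := (boxNorm_le_iff (boxNorm_nonneg w)).1 le_rfl
  refine (boxNorm_le_iff (add_nonneg (boxNorm_nonneg v) (boxNorm_nonneg w))).2 fun i => ⟨?_, ?_⟩
  · exact (abs_add_le _ _).trans (add_le_add (hv i).1 (hw i).1)
  · exact (abs_add_le _ _).trans (add_le_add (hv i).2 (hw i).2)

theorem boxNorm_smul {n : ℕ} {t : ℝ} (ht : 0 ≤ t) (v : Fin n → ℂ) :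
    boxNorm (t • v) = t * boxNorm v := by
  simp only [boxNorm, Pi.smul_apply, Complex.smul_re, Complex.smul_im, smul_eq_mul, abs_mul,
    abs_of_nonneg ht, ← mul_max_of_nonneg _ _ ht, Real.mul_iSup_of_nonneg ht]

theorem boxNorm_neg {n : ℕ} (v : Fin n → ℂ) : boxNorm (-v) = boxNorm v := by
  simp [boxNorm]

theorem eq_zero_of_boxNorm_eq_zero {n : ℕ} {v : Fin n → ℂ} (h : boxNorm v = 0) : v = 0 := by
  funext i
  have hi := (boxNorm_le_iff le_rfl).1 h.le i
  exact Complex.ext (abs_nonpos_iff.1 hi.1) (abs_nonpos_iff.1 hi.2)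

theorem convex_boxNorm_sub_le {n : ℕ} (x : Fin n → ℂ) (r : ℝ) :
    Convex ℝ {y : Fin n → ℂ | boxNorm (y - x) ≤ r} := by
  intro y hy z hz a b ha hb hab
  have hsplit : a • y + b • z - x = a • (y - x) + b • (z - x) := by
    rw [smul_sub, smul_sub, sub_add_sub_comm, ← add_smul, hab, one_smul]
  simp only [Set.mem_ofPred_eq] at hy hz ⊢
  calc boxNorm (a • y + b • z - x) ≤ a * boxNorm (y - x) + b * boxNorm (z - x) := by
        rw [hsplit, ← boxNorm_smul ha, ← boxNorm_smul hb]
        exact boxNorm_add_le _ _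
    _ ≤ a * r + b * r := by gcongr
    _ = r := by rw [← add_mul, hab, one_mul]

/-- If `c + L b` stays in the box of radius `R` for every `b` in the unit box, then `L` has
operator norm at most `R` for `boxNorm`. -/
theorem boxNorm_map_le_of_translate {n : ℕ} (L : (Fin n → ℂ) →ₗ[ℝ] (Fin n → ℂ))
    (c : Fin n → ℂ) {R : ℝ} (h : ∀ b, boxNorm b ≤ 1 → boxNorm (c + L b) ≤ R) (d : Fin n → ℂ) :
    boxNorm (L d) ≤ R * boxNorm d := by
  have unit_bound : ∀ b, boxNorm b ≤ 1 → boxNorm (L b) ≤ R := by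
    intro b hb
    have hpos := h b hb
    have hneg := h (-b) (by rwa [boxNorm_neg])
    have hsum := boxNorm_add_le (c + L b) (-(c + L (-b)))
    have htwo : c + L b + -(c + L (-b)) = (2 : ℝ) • L b := by
      rw [map_neg, two_smul]; abel
    rw [htwo, boxNorm_neg, boxNorm_smul zero_le_two] at hsum
    linarith
  rcases (boxNorm_nonneg d).eq_or_lt with h0 | h0
  · simp [eq_zero_of_boxNorm_eq_zero h0.symm, boxNorm]
  · have hb := unit_bound ((boxNorm d)⁻¹ • d) (by
      rw [boxNorm_smul (inv_nonneg.2 h0.le), inv_mul_cancel₀ h0.ne'])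
    rw [map_smul, boxNorm_smul (inv_nonneg.2 h0.le)] at hb
    rwa [inv_mul_le_iff₀ h0, mul_comm] at hb

/-- Mean value inequality for `boxNorm` on a convex set. -/
theorem boxNorm_image_sub_le_of_hasFDerivAt {n : ℕ} {s : Set (Fin n → ℂ)} (hs : Convex ℝ s)
    {f : (Fin n → ℂ) → (Fin n → ℂ)} {f' : (Fin n → ℂ) → (Fin n → ℂ) →L[ℝ] (Fin n → ℂ)}
    (hf : ∀ w ∈ s, HasFDerivAt f (f' w) w) {y z : Fin n → ℂ} (hy : y ∈ s) (hz : z ∈ s)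
    {C : ℝ} (hC : ∀ w ∈ s, boxNorm (f' w (y - z)) ≤ C) :
    boxNorm (f y - f z) ≤ C := by
  have hC0 : 0 ≤ C := (boxNorm_nonneg _).trans (hC y hy)
  have functional_bound : ∀ l : (Fin n → ℂ) →L[ℝ] ℝ,
      (∀ v, boxNorm v ≤ C → |l v| ≤ C) → |l (f y - f z)| ≤ C := by
    intro l hl
    have hmem : ∀ t ∈ Set.Icc (0 : ℝ) 1, AffineMap.lineMap z y t ∈ s :=
      fun t ht => hs.lineMap_mem hz hy ht
    have hderiv : ∀ t ∈ Set.Icc (0 : ℝ) 1,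
        HasDerivWithinAt (fun t : ℝ => l (f (AffineMap.lineMap z y t)))
          (l (f' (AffineMap.lineMap z y t) (y - z))) (Set.Icc 0 1) t := fun t ht =>
      (l.hasFDerivAt.comp_hasDerivAt t
        ((hf _ (hmem t ht)).comp_hasDerivAt t AffineMap.hasDerivAt_lineMap)).hasDerivWithinAt
    simpa [map_sub] using norm_image_sub_le_of_norm_deriv_le_segment_01' hderiv
      fun t ht => hl _ (hC _ (hmem t (Set.Ico_subset_Icc_self ht)))
  refine (boxNorm_le_iff hC0).2 fun i => ⟨?_, ?_⟩
  · exact functional_bound (Complex.reCLM.comp (ContinuousLinearMap.proj i))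
      fun v hv => ((boxNorm_le_iff hC0).1 hv i).1
  · exact functional_bound (Complex.imCLM.comp (ContinuousLinearMap.proj i))
      fun v hv => ((boxNorm_le_iff hC0).1 hv i).2

/-- Under the Krawczyk hypothesis, the quasi-Newton map `N(y) = y − A·F(y)` is
`ρ`-Lipschitz on the box `x + rB` for the real sup-norm. -/
theorem krawczyk_quasiNewton_lipschitz
    {n : ℕ} (hn : 1 ≤ n)
    (F : (Fin n → ℂ) → (Fin n → ℂ)) (x : Fin n → ℂ) (r : ℝ) (hr : 0 < r)
    (U : Set (Fin n → ℂ)) (hU : IsOpen U)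
    (hbox : {y : Fin n → ℂ | boxNorm (y - x) ≤ r} ⊆ U)
    (hF : DifferentiableOn ℂ F U)
    (A : Matrix (Fin n) (Fin n) ℂ) (hA : IsUnit A.det)
    (ρ : ℝ) (hρ0 : 0 < ρ) (hρ1 : ρ < 1)
    (hK : ∀ y : Fin n → ℂ, boxNorm (y - x) ≤ r →
      ∀ b : Fin n → ℂ, boxNorm b ≤ 1 →
        boxNorm (-(A.mulVec (F x)) + r • (b - A.mulVec (fderiv ℂ F y b))) ≤ r * ρ) :
    ∀ y : Fin n → ℂ, boxNorm (y - x) ≤ r → ∀ z : Fin n → ℂ, boxNorm (z - x) ≤ r →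
      boxNorm ((y - A.mulVec (F y)) - (z - A.mulVec (F z))) ≤ ρ * boxNorm (y - z) := by
  intro y hy z hz
  let M : (Fin n → ℂ) →L[ℂ] (Fin n → ℂ) := A.mulVecLin.toContinuousLinearMap
  let N' : (Fin n → ℂ) → (Fin n → ℂ) →L[ℝ] (Fin n → ℂ) := fun w =>
    (ContinuousLinearMap.id ℂ (Fin n → ℂ) - M.comp (fderiv ℂ F w)).restrictScalars ℝ
  have hN : ∀ w ∈ {w : Fin n → ℂ | boxNorm (w - x) ≤ r},
      HasFDerivAt (fun w => w - A.mulVec (F w)) (N' w) w := fun w hw =>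
    ((hasFDerivAt_id w).sub (M.hasFDerivAt.comp w
      ((hF.differentiableAt (hU.mem_nhds (hbox hw))).hasFDerivAt))).restrictScalars ℝ
  refine boxNorm_image_sub_le_of_hasFDerivAt (convex_boxNorm_sub_le x r) hN hy hz fun w hw => ?_
  have hbound := boxNorm_map_le_of_translate (r • (N' w : (Fin n → ℂ) →ₗ[ℝ] (Fin n → ℂ)))
    (-(A.mulVec (F x))) (hK w hw) (y - z)
  rw [LinearMap.smul_apply, boxNorm_smul hr.le, mul_assoc] at hbound
  exact le_of_mul_le_mul_left hbound hr
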